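/- Let (Ω, ℱ, ℙ) be a probability space, M ≥ 2, a < b, h = (b−a)/M, Δt > 0, C₁ ∈ ℝ, η₁ ∈ ℝ^{M−1}, and let Ã be the sine pseudo-spectral differentiation matrix. Let Pⁿ, Qⁿ : Ω → ℝ^{M−1} (0 ≤ n ≤ N) and Uⁿ : Ω → ℝ^{M−1} (1 ≤ n ≤ N) be random vectors with E‖Pⁿ‖_h² < ∞ and E‖Qⁿ‖_h² < ∞ for all n, and for each 1 ≤ n ≤ N let β₀ⁿ, β₁ⁿ be N(0, Δt)-distributed real random variables such that the pair (β₀ⁿ, β₁ⁿ) is independent of (Pⁿ⁻¹, Qⁿ⁻¹). Suppose that almost surely, for each 1 ≤ n ≤ N, Pⁿ = Pⁿ⁻¹ − Δt( Ã((Qⁿ+Qⁿ⁻¹)/2) + (1/2)·Uⁿ ⊙ (Qⁿ+Qⁿ⁻¹) ) + C₁ β₁ⁿ η₁ + (1/2)·Δt C₁ β₀ⁿ ( Ã η₁ + Uⁿ ⊙ η₁ ) and Qⁿ = Qⁿ⁻¹ + Δt( Ã((Pⁿ+Pⁿ⁻¹)/2) + (1/2)·Uⁿ ⊙ (Pⁿ+Pⁿ⁻¹)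 ) − C₁ β₀ⁿ η₁ + (1/2)·Δt C₁ β₁ⁿ ( Ã η₁ + Uⁿ ⊙ η₁ ). Then for every 0 ≤ n ≤ N, E[𝒩(Pⁿ, Qⁿ)] = E[𝒩(P⁰, Q⁰)] + 2 C₁² ‖η₁‖_h² · n Δt. -/

import Mathlib

open MeasureTheory ProbabilityTheory

/-- Weighted discrete inner product `⟨f, g⟩_h = h ∑ i f i * g i`. -/
noncomputable def iph {m : ℕ} (h : ℝ) (f g : Fin m → ℝ) : ℝ := h * ∑ i, f i * g i

/-- Squared discrete norm `‖f‖_h² = h ∑ i (f i)²`. -/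
noncomputable def nsq {m : ℕ} (h : ℝ) (f : Fin m → ℝ) : ℝ := h * ∑ i, f i * f i

/-- The `(M-1) × (M-1)` sine pseudo-spectral differentiation matrix on `[a,b]`,
with `μ = π/(b-a)`, `h = (b-a)/M`, and indices running over `1 ≤ i,j ≤ M-1`
(`Fin (M-1)` index `i` corresponds to the index `i+1`). -/
noncomputable def spsMatrix (M : ℕ) (a b : ℝ) : Matrix (Fin (M - 1)) (Fin (M - 1)) ℝ :=
  Matrix.of fun i j =>
    let μ : ℝ := Real.pi / (b - a)
    let h : ℝ := (b - a) / M
    if (i : ℕ) = (j : ℕ) then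
      -μ ^ 2 / 6 - (M : ℝ) ^ 2 * μ ^ 2 / 3
        + μ ^ 2 / 2 * (1 / Real.sin ((((i : ℕ) + 1 : ℕ) : ℝ) * μ * h)) ^ 2
    else
      (-1 : ℝ) ^ (((i : ℕ) + 1) + ((j : ℕ) + 1) + 1) * (μ ^ 2 / 2)
        * ((1 / Real.sin (μ / 2 * (((((i : ℕ) + 1 : ℕ) : ℝ)) - ((((j : ℕ) + 1 : ℕ) : ℝ))) * h)) ^ 2
          - (1 / Real.sin (μ / 2 * (((((i : ℕ) + 1 : ℕ) : ℝ)) + ((((j : ℕ) + 1 : ℕ) : ℝ))) * h)) ^ 2)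

lemma spsMatrix_isSymm (M : ℕ) (a b : ℝ) : (spsMatrix M a b).IsSymm := by
  ext i j
  simp only [Matrix.transpose_apply, spsMatrix, Matrix.of_apply]
  by_cases hij : (i : ℕ) = (j : ℕ)
  · rw [if_pos hij, if_pos hij.symm, hij]
  · rw [if_neg hij, if_neg (Ne.symm hij),
      show (Real.pi / (b - a) / 2 * ((((j : ℕ) + 1 : ℕ) : ℝ) - (((i : ℕ) + 1 : ℕ) : ℝ)) * ((b - a) / M))
        = -(Real.pi / (b - a) / 2 * ((((i : ℕ) + 1 : ℕ) : ℝ) - (((j : ℕ) + 1 : ℕ) : ℝ))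
          * ((b - a) / M)) by ring,
      Real.sin_neg, add_comm ((((j : ℕ) + 1 : ℕ) : ℝ)), add_comm ((j : ℕ) + 1) ((i : ℕ) + 1)]
    ring

/-- An implicit midpoint step generated by a symmetric operator preserves the charge. -/
lemma dotProduct_charge_eq_of_midpoint {ι : Type*} [Fintype ι] {L : Matrix ι ι ℝ} (hL : L.IsSymm)
    (c : ℝ) {p q p' q' : ι → ℝ} (hp : p' = p - c • L.mulVec (q' + q))
    (hq : q' = q + c • L.mulVec (p' + p)) :
    p' ⬝ᵥ p' + q' ⬝ᵥ q' = p ⬝ᵥ p + q ⬝ᵥ q := by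
  have h1 : (p' - p) ⬝ᵥ (p' + p) = -(c * (L.mulVec (q' + q) ⬝ᵥ (p' + p))) := by
    rw [show p' - p = -(c • L.mulVec (q' + q)) by nth_rw 1 [hp]; abel]
    rw [neg_dotProduct, smul_dotProduct, smul_eq_mul]
  have h2 : (q' - q) ⬝ᵥ (q' + q) = c * (L.mulVec (p' + p) ⬝ᵥ (q' + q)) := by
    rw [show q' - q = c • L.mulVec (p' + p) by nth_rw 1 [hq]; abel]
    rw [smul_dotProduct, smul_eq_mul]
  have h3 : L.mulVec (q' + q) ⬝ᵥ (p' + p) = L.mulVec (p' + p) ⬝ᵥ (q' + q) := by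
    rw [dotProduct_comm (L.mulVec (q' + q)), Matrix.dotProduct_mulVec, ← Matrix.mulVec_transpose,
      hL.eq]
  rw [h3] at h1
  simp only [sub_dotProduct, dotProduct_add] at h1 h2
  linarith [dotProduct_comm p p', dotProduct_comm q q']

lemma nsq_eq_dotProduct {m : ℕ} (h : ℝ) (f : Fin m → ℝ) : nsq h f = h * (f ⬝ᵥ f) := rfl

/-- Pathwise charge balance of one step of the scheme. -/
lemma nsq_add_nsq_of_step {m : ℕ} (h Δt C β0 β1 : ℝ) {A : Matrix (Fin m) (Fin m) ℝ}
    (hA : A.IsSymm) {η p q P Q U : Fin m → ℝ}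
    (hP : P = p - Δt • (A.mulVec ((2 : ℝ)⁻¹ • (Q + q)) + (2 : ℝ)⁻¹ • (U * (Q + q)))
      + (C * β1) • η + ((2 : ℝ)⁻¹ * Δt * C * β0) • (A.mulVec η + U * η))
    (hQ : Q = q + Δt • (A.mulVec ((2 : ℝ)⁻¹ • (P + p)) + (2 : ℝ)⁻¹ • (U * (P + p)))
      - (C * β0) • η + ((2 : ℝ)⁻¹ * Δt * C * β1) • (A.mulVec η + U * η)) :
    nsq h P + nsq h Q = nsq h p + nsq h q + 2 * C * h * (β1 * (p ⬝ᵥ η))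
      - 2 * C * h * (β0 * (q ⬝ᵥ η)) + C ^ 2 * nsq h η * (β0 ^ 2 + β1 ^ 2) := by
  have hL : (A + Matrix.diagonal U).IsSymm := hA.add (Matrix.isSymm_diagonal U)
  have hLv (v : Fin m → ℝ) : (A + Matrix.diagonal U).mulVec v = A.mulVec v + U * v := by
    ext i
    simp [Matrix.add_mulVec, Matrix.mulVec_diagonal]
  have key := dotProduct_charge_eq_of_midpoint hL (Δt / 2)
    (p := p + (C * β1) • η) (q := q - (C * β0) • η) (p' := P) (q' := Q)
    (by
      rw [hLv]
      nth_rw 1 [hP]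
      ext i
      simp [Matrix.mulVec_add, Matrix.mulVec_sub, Matrix.mulVec_smul]
      ring)
    (by
      rw [hLv]
      nth_rw 1 [hQ]
      ext i
      simp [Matrix.mulVec_add, Matrix.mulVec_smul]
      ring)
  simp only [nsq_eq_dotProduct]
  rw [← mul_add, key]
  simp only [add_dotProduct, sub_dotProduct, dotProduct_add, dotProduct_sub, smul_dotProduct,
    dotProduct_smul, smul_eq_mul, dotProduct_comm η p, dotProduct_comm η q]
  ring

lemma integrable_dotProduct_of_integrable_nsq {Ω : Type*} [MeasurableSpace Ω] {μ : Measure Ω}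
    [IsFiniteMeasure μ] {m : ℕ} {h : ℝ} (hh : 0 < h) {X : Ω → Fin m → ℝ} (hX : Measurable X)
    (hXi : Integrable (fun ω => nsq h (X ω)) μ) (η : Fin m → ℝ) :
    Integrable (fun ω => X ω ⬝ᵥ η) μ := by
  refine integrable_finsetSum _ fun i _ => Integrable.mul_const ?_ _
  have hm : Measurable fun ω => X ω i := (measurable_pi_apply i).comp hX
  refine MemLp.integrable (q := 2) (by norm_num)
    ((memLp_two_iff_integrable_sq hm.aestronglyMeasurable).2 ?_)
  refine (hXi.const_mul h⁻¹).mono' (hm.pow_const 2).aestronglyMeasurable (ae_of_all _ fun ω => ?_)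
  rw [nsq, inv_mul_cancel_left₀ hh.ne', Real.norm_of_nonneg (sq_nonneg _), sq]
  exact Finset.single_le_sum (f := fun i => X ω i * X ω i) (fun j _ => mul_self_nonneg _)
    (Finset.mem_univ i)

section Gaussian

variable {Ω : Type*} [MeasurableSpace Ω] {μ : Measure Ω} {β : Ω → ℝ} {v : NNReal}

lemma memLp_two_of_map_eq_gaussianReal (hm : Measurable β) (hβ : μ.map β = gaussianReal 0 v) :
    MemLp β 2 μ := by
  have : MemLp id 2 (μ.map β) := hβ ▸ memLp_id_gaussianReal 2
  exact (memLp_map_measure_iff aestronglyMeasurable_id hm.aemeasurable).1 this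

lemma integral_eq_zero_of_map_eq_gaussianReal (hm : Measurable β)
    (hβ : μ.map β = gaussianReal 0 v) : ∫ ω, β ω ∂μ = 0 := by
  have := integral_map (μ := μ) hm.aemeasurable (f := fun x : ℝ => x) aestronglyMeasurable_id
  rw [← this, hβ, integral_id_gaussianReal]

lemma integral_sq_of_map_eq_gaussianReal (hm : Measurable β)
    (hβ : μ.map β = gaussianReal 0 v) : ∫ ω, β ω ^ 2 ∂μ = v := by
  have h1 := integral_map (μ := μ) hm.aemeasurable (f := fun x : ℝ => x ^ 2)
    (by fun_prop)
  have h2 := variance_id_gaussianReal (μ := 0) (v := v)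
  rw [variance_of_integral_eq_zero aemeasurable_id (by simp)] at h2
  rw [← h1, hβ]
  simpa using h2

end Gaussian

/-- Averaged charge balance of one step of the scheme. -/
lemma integral_charge_step {Ω : Type*} [MeasurableSpace Ω] {μ : Measure Ω}
    [IsProbabilityMeasure μ] {m : ℕ} {h C : ℝ} (hh : 0 < h) {v : NNReal} {η : Fin m → ℝ}
    {p q P Q : Ω → Fin m → ℝ} {β0 β1 : Ω → ℝ} (hp : Measurable p) (hq : Measurable q)
    (hpi : Integrable (fun ω => nsq h (p ω)) μ) (hqi : Integrable (fun ω => nsq h (q ω)) μ)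
    (hβ0m : Measurable β0) (hβ1m : Measurable β1)
    (hβ0 : μ.map β0 = gaussianReal 0 v) (hβ1 : μ.map β1 = gaussianReal 0 v)
    (hind : IndepFun (fun ω => (β0 ω, β1 ω)) (fun ω => (p ω, q ω)) μ)
    (hstep : ∀ᵐ ω ∂μ, nsq h (P ω) + nsq h (Q ω) = nsq h (p ω) + nsq h (q ω)
      + 2 * C * h * (β1 ω * (p ω ⬝ᵥ η)) - 2 * C * h * (β0 ω * (q ω ⬝ᵥ η))
      + C ^ 2 * nsq h η * (β0 ω ^ 2 + β1 ω ^ 2)) :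
    ∫ ω, (nsq h (P ω) + nsq h (Q ω)) ∂μ
      = ∫ ω, (nsq h (p ω) + nsq h (q ω)) ∂μ + 2 * C ^ 2 * nsq h η * v := by
  have hdot : Measurable fun x : Fin m → ℝ => x ⬝ᵥ η := by unfold dotProduct; fun_prop
  have hi1 : IndepFun β1 (fun ω => p ω ⬝ᵥ η) μ :=
    hind.comp measurable_snd (hdot.comp measurable_fst)
  have hi0 : IndepFun β0 (fun ω => q ω ⬝ᵥ η) μ :=
    hind.comp measurable_fst (hdot.comp measurable_snd)
  have hL0 := memLp_two_of_map_eq_gaussianReal hβ0m hβ0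
  have hL1 := memLp_two_of_map_eq_gaussianReal hβ1m hβ1
  have hpη := integrable_dotProduct_of_integrable_nsq hh hp hpi η
  have hqη := integrable_dotProduct_of_integrable_nsq hh hq hqi η
  have hI1 : Integrable (fun ω => β1 ω * (p ω ⬝ᵥ η)) μ :=
    hi1.integrable_mul (hL1.integrable (by norm_num)) hpη
  have hI0 : Integrable (fun ω => β0 ω * (q ω ⬝ᵥ η)) μ :=
    hi0.integrable_mul (hL0.integrable (by norm_num)) hqη
  have hE1 : ∫ ω, β1 ω * (p ω ⬝ᵥ η) ∂μ = 0 := by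
    rw [hi1.integral_fun_mul_eq_mul_integral hβ1m.aestronglyMeasurable hpη.aestronglyMeasurable,
      integral_eq_zero_of_map_eq_gaussianReal hβ1m hβ1, zero_mul]
  have hE0 : ∫ ω, β0 ω * (q ω ⬝ᵥ η) ∂μ = 0 := by
    rw [hi0.integral_fun_mul_eq_mul_integral hβ0m.aestronglyMeasurable hqη.aestronglyMeasurable,
      integral_eq_zero_of_map_eq_gaussianReal hβ0m hβ0, zero_mul]
  have hpq : Integrable (fun ω => nsq h (p ω) + nsq h (q ω)) μ := hpi.add hqi
  have hp1 : Integrable (fun ω => nsq h (p ω) + nsq h (q ω)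
      + 2 * C * h * (β1 ω * (p ω ⬝ᵥ η))) μ := hpq.add (hI1.const_mul _)
  have hp0 : Integrable (fun ω => nsq h (p ω) + nsq h (q ω)
      + 2 * C * h * (β1 ω * (p ω ⬝ᵥ η)) - 2 * C * h * (β0 ω * (q ω ⬝ᵥ η))) μ :=
    hp1.sub (hI0.const_mul _)
  have hsq : Integrable (fun ω => β0 ω ^ 2 + β1 ω ^ 2) μ := hL0.integrable_sq.add hL1.integrable_sq
  rw [integral_congr_ae hstep, integral_add hp0 (hsq.const_mul _),
    integral_sub hp1 (hI0.const_mul _), integral_add hpq (hI1.const_mul _), integral_const_mul,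
    integral_const_mul, integral_const_mul, integral_add hL0.integrable_sq hL1.integrable_sq,
    hE1, hE0, integral_sq_of_map_eq_gaussianReal hβ0m hβ0,
    integral_sq_of_map_eq_gaussianReal hβ1m hβ1]
  ring

/-- The modified finite-difference fully-discrete scheme (sine pseudo-spectral
method in space) preserves the averaged charge evolution law. -/
theorem stmt_9 {Ω : Type*} [MeasureSpace Ω] [IsProbabilityMeasure (ℙ : Measure Ω)]
    {M : ℕ} (hM : 2 ≤ M) (a b : ℝ) (hab : a < b) (h : ℝ) (hhd : h = (b - a) / M)
    (Δt : ℝ) (hΔt : 0 < Δt)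
    (C1 : ℝ) (η1 : Fin (M - 1) → ℝ) (N : ℕ)
    (P Q U : ℕ → Ω → Fin (M - 1) → ℝ)
    (hPm : ∀ n ≤ N, Measurable (P n)) (hQm : ∀ n ≤ N, Measurable (Q n))
    (hPi : ∀ n ≤ N, Integrable (fun ω => nsq h (P n ω)) ℙ)
    (hQi : ∀ n ≤ N, Integrable (fun ω => nsq h (Q n ω)) ℙ)
    (β0 β1 : ℕ → Ω → ℝ)
    (hβ0m : ∀ n, 1 ≤ n → n ≤ N → Measurable (β0 n))
    (hβ1m : ∀ n, 1 ≤ n → n ≤ N → Measurable (β1 n))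
    (hβ0 : ∀ n, 1 ≤ n → n ≤ N → Measure.map (β0 n) ℙ = gaussianReal 0 Δt.toNNReal)
    (hβ1 : ∀ n, 1 ≤ n → n ≤ N → Measure.map (β1 n) ℙ = gaussianReal 0 Δt.toNNReal)
    (hind : ∀ n, 1 ≤ n → n ≤ N →
      IndepFun (fun ω => (β0 n ω, β1 n ω)) (fun ω => (P (n - 1) ω, Q (n - 1) ω)) ℙ)
    (hscheme : ∀ᵐ ω ∂ℙ, ∀ n, 1 ≤ n → n ≤ N →
      P n ω = P (n - 1) ω
          - Δt • ((spsMatrix M a b).mulVec ((2 : ℝ)⁻¹ • (Q n ω + Q (n - 1) ω))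
              + (2 : ℝ)⁻¹ • (U n ω * (Q n ω + Q (n - 1) ω)))
          + (C1 * β1 n ω) • η1
          + ((2 : ℝ)⁻¹ * Δt * C1 * β0 n ω) • ((spsMatrix M a b).mulVec η1 + U n ω * η1)
      ∧ Q n ω = Q (n - 1) ω
          + Δt • ((spsMatrix M a b).mulVec ((2 : ℝ)⁻¹ • (P n ω + P (n - 1) ω))
              + (2 : ℝ)⁻¹ • (U n ω * (P n ω + P (n - 1) ω)))
          - (C1 * β0 n ω) • η1
          + ((2 : ℝ)⁻¹ * Δt * C1 * β1 n ω) • ((spsMatrix M a b).mulVec η1 + U n ω * η1)) :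
    ∀ n ≤ N, ∫ ω, (nsq h (P n ω) + nsq h (Q n ω)) ∂ℙ
      = (∫ ω, (nsq h (P 0 ω) + nsq h (Q 0 ω)) ∂ℙ) + 2 * C1 ^ 2 * nsq h η1 * (n * Δt) := by
  have hh : 0 < h := by
    have : (0 : ℝ) < M := by exact_mod_cast (by omega : 0 < M)
    rw [hhd]
    exact div_pos (sub_pos.2 hab) this
  intro n
  induction n with
  | zero => simp
  | succ k ih =>
    intro hk
    have hstep := integral_charge_step (C := C1) (η := η1) (P := P (k + 1)) (Q := Q (k + 1)) hh
      (hPm k (by omega)) (hQm k (by omega)) (hPi k (by omega)) (hQi k (by omega))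
      (hβ0m (k + 1) (by omega) hk) (hβ1m (k + 1) (by omega) hk)
      (hβ0 (k + 1) (by omega) hk) (hβ1 (k + 1) (by omega) hk)
      (by simpa using hind (k + 1) (by omega) hk)
      (by
        filter_upwards [hscheme] with ω hω
        obtain ⟨h1, h2⟩ := hω (k + 1) (by omega) hk
        exact nsq_add_nsq_of_step h Δt C1 _ _ (spsMatrix_isSymm M a b) h1 h2)
    rw [hstep, ih (by omega), Real.coe_toNNReal _ hΔt.le]
    push_cast
    ring
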